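/- There exist universal constants C > 0 and c > 0 with the following property. Let G : ℝ^s → ℝ^n be a d-layer feedforward neural network with at most N nodes per layer, all weights bounded by w_max in absolute value, and L-Lipschitz activations, with L·N·w_max ≥ 2. Let x* ∈ ℝ^n with ‖x*‖ = 1, let A ∈ ℝ^{m×n} be a random matrix with i.i.d. standard Gaussian N(0,1) entries, let η ∈ {±1}^m have independent entries with ℙ{η_i = 1} = α for some α ∈ (1/2, 1], independent of A, and let y = η ⊙ sign(A x*), where ⊙ is the entrywise (Hadamard) product. Fix r > 0, ε > 0 and δ ≥ 0. If m ≥ C ε^{−2} s (r² + d log(L N w_max)), then with probability at least 1 − 4 exp(−c ε² m), every z̃ ∈ ℝ^s with ‖z̃‖ ≤ r and ‖G(z̃)‖ ≤ 1 that minimizes the loss l(G(z)) = ‖G(z)‖² − (√(2π)/m) yᵀ A G(z) to within an additive δ of its infimum over {z : ‖z‖ ≤ r, ‖G(z)‖ ≤ 1} satisfies ‖G(z̃) − x*‖² ≤ inf_{‖z‖ ≤ r, ‖G(z)‖ ≤ 1} ‖G(z) − x*‖² + (δ + ε)/(2α − 1) + 2(1 − α)/(2α − 1). -/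

import Mathlib

open MeasureTheory ProbabilityTheory

noncomputable section

/-- Euclidean norm on `Fin n → ℝ`. -/
def evNorm {n : ℕ} (x : Fin n → ℝ) : ℝ := Real.sqrt (∑ i, x i ^ 2)

/-- Euclidean inner product on `Fin n → ℝ`. -/
def evInner {n : ℕ} (u v : Fin n → ℝ) : ℝ := ∑ i, u i * v i

/-- The sign function: `+1` if `p > 0` and `-1` if `p ≤ 0`. -/
def sgn (p : ℝ) : ℝ := if 0 < p then 1 else -1

/-- The law of a standard Gaussian random vector in `ℝ^n` (i.i.d. `N(0,1)` coordinates). -/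
def stdGaussianVec (n : ℕ) : Measure (Fin n → ℝ) :=
  Measure.pi fun _ => gaussianReal 0 1

/-- The law of an `m × n` random matrix with i.i.d. `N(0,1)` entries; `A i` is the `i`-th row. -/
def stdGaussianMatrix (m n : ℕ) : Measure (Fin m → Fin n → ℝ) :=
  Measure.pi fun _ => stdGaussianVec n

/-- `φ : ℝ^p → ℝ^q` is a neural-network layer with at most `N` nodes, all weights bounded
by `wmax` in absolute value, and an `L`-Lipschitz activation map:
`φ(v) = σ(W v + b)`. -/
def IsLayer (L wmax : ℝ) (N : ℕ) {p q : ℕ} (φ : (Fin p → ℝ) → (Fin q → ℝ)) : Prop :=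
  p ≤ N ∧ q ≤ N ∧
    ∃ (W : Fin q → Fin p → ℝ) (b : Fin q → ℝ) (σ : (Fin q → ℝ) → (Fin q → ℝ)),
      (∀ j k, |W j k| ≤ wmax) ∧
      (∀ v v', evNorm (σ v - σ v') ≤ L * evNorm (v - v')) ∧
      (∀ v, φ v = σ (fun j => (∑ k, W j k * v k) + b j))

/-- `IsMLP L wmax N d s n G` : `G : ℝ^s → ℝ^n` is a `d`-layer feedforward neural network with
at most `N` nodes per layer, all weights bounded by `wmax` in absolute value, and
`L`-Lipschitz activations. -/
inductive IsMLP (L wmax : ℝ) (N : ℕ) : ∀ (d s n : ℕ), ((Fin s → ℝ) → (Fin n → ℝ)) → Prop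
  | single {s n : ℕ} {φ : (Fin s → ℝ) → (Fin n → ℝ)} (h : IsLayer L wmax N φ) :
      IsMLP L wmax N 1 s n φ
  | comp {d s p n : ℕ} {G : (Fin s → ℝ) → (Fin p → ℝ)} {φ : (Fin p → ℝ) → (Fin n → ℝ)}
      (hG : IsMLP L wmax N d s p G) (hφ : IsLayer L wmax N φ) :
      IsMLP L wmax N (d + 1) s n (fun z => φ (G z))

/-- The one-bit compressed-sensing loss `l(x) = ‖x‖² − (√(2π)/m) yᵀ A x`. -/
def ocsLoss {m n : ℕ} (A : Fin m → Fin n → ℝ) (y : Fin m → ℝ) (x : Fin n → ℝ) : ℝ :=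
  evNorm x ^ 2 - (Real.sqrt (2 * Real.pi) / m) * ∑ i, y i * evInner (A i) x

/-- The law of a `±1`-valued random variable taking value `1` with probability `α`
and `-1` with probability `1 - α`. -/
def etaMeasure (α : ℝ) : Measure ℝ :=
  (Real.toNNReal α) • Measure.dirac (1 : ℝ) +
    (Real.toNNReal (1 - α)) • Measure.dirac (-1 : ℝ)

/-- The law of a vector of `m` independent such `±1`-valued entries. -/
def etaVec (m : ℕ) (α : ℝ) : Measure (Fin m → ℝ) := Measure.pi fun _ => etaMeasure α


theorem exists_finset_cover_ball_two (E : Type*) [NormedAddCommGroup E] [NormedSpace ℝ E]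
    [FiniteDimensional ℝ E] :
    ∃ Q : Finset E, Q.card ≤ 5 ^ Module.finrank ℝ E ∧ ∀ z : E, ‖z‖ ≤ 2 → ∃ q ∈ Q, ‖z - q‖ ≤ 1 := by
  classical
  let S : Set ℕ := {k | ∃ Q : Finset E, (∀ c ∈ Q, ‖c‖ ≤ 2) ∧
    (∀ c ∈ Q, ∀ d ∈ Q, c ≠ d → 1 ≤ ‖c - d‖) ∧ Q.card = k}
  have hbdd : BddAbove S := ⟨5 ^ Module.finrank ℝ E, by
    rintro k ⟨Q, h1, h2, rfl⟩
    exact Besicovitch.card_le_of_separated Q h1 h2⟩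
  have hne : S.Nonempty := ⟨0, ∅, by simp⟩
  obtain ⟨Q, h1, h2, h3⟩ := Nat.sSup_mem hne hbdd
  refine ⟨Q, Besicovitch.card_le_of_separated Q h1 h2, fun z hz => ?_⟩
  by_contra! hcon
  have hzQ : z ∉ Q := fun h => by
    have := hcon z h
    simp at this
    linarith
  have hmem : Q.card + 1 ∈ S := by
    refine ⟨insert z Q, ?_, ?_, Finset.card_insert_of_notMem hzQ⟩
    · intro c hc
      rcases Finset.mem_insert.1 hc with rfl | hc
      exacts [hz, h1 c hc]
    · intro c hc d hd hcd
      rcases Finset.mem_insert.1 hc with hcz | hcQ <;>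
        rcases Finset.mem_insert.1 hd with hdz | hdQ
      · exact absurd (hcz.trans hdz.symm) hcd
      · rw [hcz]; exact (hcon d hdQ).le
      · rw [hdz, norm_sub_rev]; exact (hcon c hcQ).le
      · exact h2 c hcQ d hdQ hcd
  have := le_csSup hbdd hmem
  omega

theorem exists_finset_cover_ball_dyadic (E : Type*) [NormedAddCommGroup E] [NormedSpace ℝ E]
    [FiniteDimensional ℝ E] {r : ℝ} (hr : 0 < r) (k : ℕ) :
    ∃ P : Finset E, P.card ≤ 5 ^ (Module.finrank ℝ E * k) ∧
      ∀ z : E, ‖z‖ ≤ r → ∃ p ∈ P, ‖z - p‖ ≤ r / 2 ^ k := by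
  classical
  obtain ⟨Q, hQ, hQc⟩ := exists_finset_cover_ball_two E
  induction k with
  | zero => exact ⟨{0}, by simp, fun z hz => ⟨0, by simp, by simpa using hz⟩⟩
  | succ k ih =>
    obtain ⟨P, hP, hPc⟩ := ih
    have hρ : 0 < r / 2 ^ (k + 1) := by positivity
    refine ⟨(P ×ˢ Q).image fun pq => pq.1 + (r / 2 ^ (k + 1)) • pq.2, ?_, fun z hz => ?_⟩
    · calc _ ≤ (P ×ˢ Q).card := Finset.card_image_le
        _ = P.card * Q.card := Finset.card_product _ _
        _ ≤ 5 ^ (Module.finrank ℝ E * k) * 5 ^ Module.finrank ℝ E := Nat.mul_le_mul hP hQ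
        _ = _ := by rw [← pow_add]; ring_nf
    · obtain ⟨p, hp, hzp⟩ := hPc z hz
      have h2 : ‖(r / 2 ^ (k + 1))⁻¹ • (z - p)‖ ≤ 2 := by
        rw [norm_smul, norm_inv, Real.norm_of_nonneg hρ.le, inv_mul_le_iff₀ hρ]
        calc _ ≤ _ := hzp
          _ = _ := by rw [pow_succ]; field_simp
      obtain ⟨q, hq, hzq⟩ := hQc _ h2
      refine ⟨_, Finset.mem_image_of_mem _ (Finset.mk_mem_product hp hq), ?_⟩
      have : z - (p + (r / 2 ^ (k + 1)) • q) =
          (r / 2 ^ (k + 1)) • ((r / 2 ^ (k + 1))⁻¹ • (z - p) - q) := by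
        rw [smul_sub, smul_inv_smul₀ hρ.ne']; abel
      rw [this, norm_smul, Real.norm_of_nonneg hρ.le]
      exact mul_le_of_le_one_right hρ.le hzq

open scoped RealInnerProductSpace in
theorem stdGaussian_map_inner {E : Type*} [NormedAddCommGroup E] [InnerProductSpace ℝ E]
    [FiniteDimensional ℝ E] [MeasurableSpace E] [BorelSpace E] (u : E) :
    (stdGaussian E).map (fun a => ⟪u, a⟫) = gaussianReal 0 (‖u‖₊ ^ 2) := by
  have hm : Measurable fun a : E => ⟪u, a⟫ := by fun_prop
  have := Measure.isProbabilityMeasure_map (μ := stdGaussian E) hm.aemeasurable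
  apply Measure.ext_of_charFun
  ext t
  have h := charFun_stdGaussian (t • u)
  rw [charFun_gaussianReal, charFun_apply, integral_map hm.aemeasurable (by fun_prop)]
  rw [charFun_apply] at h
  have h2 : ∀ x : E, ⟪x, t • u⟫ = ⟪⟪u, x⟫, t⟫ := fun x => by
    rw [inner_smul_right, real_inner_comm]; simp
  simp_rw [h2] at h
  rw [h, norm_smul]
  congr 1
  have h3 : ‖t‖ ^ 2 = t ^ 2 := by rw [Real.norm_eq_abs, sq_abs]
  have : (‖t‖ * ‖u‖) ^ 2 = ‖u‖ ^ 2 * t ^ 2 := by rw [mul_pow, h3]; ring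
  rw [← Complex.ofReal_pow, this]
  push_cast
  simp
  ring

theorem integral_abs_gaussianReal_zero_one :
    ∫ x, |x| ∂(gaussianReal 0 1) = Real.sqrt (2 / Real.pi) := by
  rw [integral_gaussianReal_eq_integral_smul one_ne_zero]
  have h1 : ∀ x : ℝ, gaussianPDFReal 0 1 x • |x| =
      (fun y : ℝ => (Real.sqrt (2 * Real.pi))⁻¹ * (y ^ (1 : ℝ) * Real.exp (-(1 / 2) * y ^ (2 : ℝ))))
        |x| := fun x => by
    simp only [gaussianPDFReal, smul_eq_mul, Real.rpow_one, Real.rpow_two, sq_abs]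
    simp
    ring_nf
  simp_rw [h1]
  rw [integral_comp_abs (f := fun y : ℝ => (Real.sqrt (2 * Real.pi))⁻¹ *
    (y ^ (1 : ℝ) * Real.exp (-(1 / 2) * y ^ (2 : ℝ)))), integral_const_mul,
    integral_rpow_mul_exp_neg_mul_rpow (by norm_num) (by norm_num) (by norm_num)]
  norm_num
  have h2 : (0:ℝ) < Real.sqrt 2 := by positivity
  have h3 : (0:ℝ) < Real.sqrt Real.pi := by positivity
  field_simp
  nlinarith [Real.sq_sqrt (show (0:ℝ) ≤ 2 by norm_num)]

theorem measurable_sgn : Measurable sgn :=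
  Measurable.ite measurableSet_Ioi measurable_const measurable_const

theorem sgn_mul_self (p : ℝ) : sgn p * p = |p| := by
  unfold sgn
  split_ifs with h
  · rw [abs_of_pos h, one_mul]
  · rw [abs_of_nonpos (not_lt.1 h), neg_one_mul]

theorem abs_sgn (p : ℝ) : |sgn p| = 1 := by
  unfold sgn
  split_ifs <;> simp

open scoped RealInnerProductSpace in
theorem integral_sgn_inner_mul_inner {E : Type*} [NormedAddCommGroup E] [InnerProductSpace ℝ E]
    [FiniteDimensional ℝ E] [MeasurableSpace E] [BorelSpace E] {x : E} (hx : ‖x‖ = 1) (u : E) :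
    ∫ a, sgn ⟪x, a⟫ * ⟪u, a⟫ ∂(stdGaussian E) = Real.sqrt (2 / Real.pi) * ⟪x, u⟫ := by
  set γ := stdGaussian E
  have hinteg : ∀ v : E, Integrable (fun a => sgn ⟪x, a⟫ * ⟪v, a⟫) γ := fun v => by
    have h1 : Integrable (fun a : E => ⟪v, a⟫) γ :=
      (innerSL ℝ v).integrable_comp IsGaussian.integrable_id
    refine h1.bdd_mul (c := 1) (measurable_sgn.comp (by fun_prop)).aestronglyMeasurable ?_
    exact Filter.Eventually.of_forall fun a => by rw [Real.norm_eq_abs, abs_sgn]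
  have hself : ∫ a, sgn ⟪x, a⟫ * ⟪x, a⟫ ∂γ = Real.sqrt (2 / Real.pi) := by
    simp_rw [sgn_mul_self]
    rw [← integral_abs_gaussianReal_zero_one]
    have h := stdGaussian_map_inner x
    have hx' : ‖x‖₊ = 1 := by ext; simpa using hx
    rw [hx', one_pow] at h
    rw [← h, integral_map (by fun_prop) (by fun_prop)]
  have horth : ∀ w : E, ⟪x, w⟫ = 0 → ∫ a, sgn ⟪x, a⟫ * ⟪w, a⟫ ∂γ = 0 := fun w hw => by
    let R : E ≃ₗᵢ[ℝ] E := (ℝ ∙ x).reflection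
    have hRx : R x = x :=
      Submodule.reflection_mem_subspace_eq_self (Submodule.mem_span_singleton_self x)
    have hRw : R w = -w := Submodule.reflection_mem_subspace_orthogonalComplement_eq_neg
      (Submodule.mem_orthogonal_singleton_iff_inner_right.2 hw)
    have h1 : ∀ a, ⟪x, R a⟫ = ⟪x, a⟫ := fun a => by
      conv_lhs => rw [← hRx]
      exact R.inner_map_map x a
    have h2 : ∀ a, ⟪w, R a⟫ = -⟪w, a⟫ := fun a => by
      rw [← R.inner_map_map w a, hRw, inner_neg_left, neg_neg]
    have h3 : ∫ a, sgn ⟪x, a⟫ * ⟪w, a⟫ ∂γ = ∫ a, sgn ⟪x, a⟫ * ⟪w, a⟫ ∂(γ.map R) := by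
      rw [stdGaussian_map R]
    rw [integral_map R.continuous.aemeasurable] at h3
    · simp_rw [h1, h2, mul_neg] at h3
      rw [integral_neg] at h3
      linarith
    · exact ((measurable_sgn.comp (by fun_prop)).mul (by fun_prop)).aestronglyMeasurable
  have hdec : ∀ a, sgn ⟪x, a⟫ * ⟪u, a⟫ =
      ⟪x, u⟫ * (sgn ⟪x, a⟫ * ⟪x, a⟫) + sgn ⟪x, a⟫ * ⟪u - ⟪x, u⟫ • x, a⟫ := fun a => by
    rw [inner_sub_left, real_inner_smul_left]; ring
  simp_rw [hdec]
  rw [integral_add ((hinteg x).const_mul _) (hinteg _), integral_const_mul, hself, horth, add_zero,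
    mul_comm]
  rw [inner_sub_right, real_inner_smul_right, real_inner_self_eq_norm_sq, hx]
  ring

theorem hasSubgaussianMGF_sub_integral_of_abs_eq {Ω : Type*} [MeasurableSpace Ω] {μ : Measure Ω}
    [IsProbabilityMeasure μ] {X Y : Ω → ℝ} {v : NNReal} (hX : Measurable X) (hY : AEMeasurable Y μ)
    (hXY : ∀ᵐ ω ∂μ, |X ω| = |Y ω|) (hlaw : μ.map Y = gaussianReal 0 v) :
    HasSubgaussianMGF (fun ω => X ω - ∫ ω', X ω' ∂μ) (2 * v) μ := by
  have hYint : ∀ t : ℝ, Integrable (fun ω => Real.exp (t * Y ω)) μ := fun t => by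
    have h := integrable_exp_mul_gaussianReal (μ := 0) (v := v) t
    rw [← hlaw, integrable_map_measure (by fun_prop) hY] at h
    exact h
  have hYmgf : ∀ t : ℝ, ∫ ω, Real.exp (t * Y ω) ∂μ = Real.exp (v * t ^ 2 / 2) := fun t => by
    have h := mgf_gaussianReal hlaw t
    simpa [mgf] using h
  have hsum : ∀ t : ℝ, ∀ᵐ ω ∂μ, Real.exp (t * X ω) + Real.exp (-t * X ω) =
      Real.exp (t * Y ω) + Real.exp (-t * Y ω) := fun t => by
    filter_upwards [hXY] with ω hω
    rcases abs_eq_abs.1 hω with h | h <;> rw [h]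
    rw [add_comm]; simp
  have hXint : ∀ t : ℝ, Integrable (fun ω => Real.exp (t * X ω)) μ := fun t => by
    refine ((hYint t).add (hYint (-t))).mono' (by fun_prop) ?_
    filter_upwards [hsum t] with ω hω
    rw [Real.norm_eq_abs, abs_of_pos (Real.exp_pos _), Pi.add_apply, ← hω]
    linarith [Real.exp_pos (-t * X ω)]
  have hXi : Integrable X μ := by
    refine ((hXint 1).add (hXint (-1))).mono' hX.aestronglyMeasurable ?_
    filter_upwards with ω
    rw [Real.norm_eq_abs, Pi.add_apply, abs_le]
    constructor <;> linarith [Real.add_one_le_exp (1 * X ω), Real.add_one_le_exp (-1 * X ω),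
      Real.exp_pos (1 * X ω), Real.exp_pos (-1 * X ω)]
  set e := ∫ ω', X ω' ∂μ with he
  have hexp : ∀ t ω, Real.exp (t * (X ω - e)) = Real.exp (-t * e) * Real.exp (t * X ω) :=
    fun t ω => by rw [← Real.exp_add]; ring_nf
  refine ⟨fun t => by simp_rw [hexp]; exact (hXint t).const_mul _, fun t => ?_⟩
  have hjensen : Real.exp (-t * e) ≤ ∫ ω, Real.exp (-t * X ω) ∂μ := by
    have h1 : ∫ ω, (Real.exp (-t * e) * (-t * X ω - -t * e + 1)) ∂μ ≤
        ∫ ω, Real.exp (-t * X ω) ∂μ := by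
      refine integral_mono ?_ (hXint (-t)) fun ω => ?_
      · exact (((hXi.const_mul _).sub (integrable_const _)).add (integrable_const _)).const_mul _
      · calc _ ≤ Real.exp (-t * e) * Real.exp (-t * X ω - -t * e) := by
              gcongr; exact Real.add_one_le_exp _
          _ = _ := by rw [← Real.exp_add]; ring_nf
    have h2 : ∫ ω, (-t * X ω - -t * e + 1) ∂μ = 1 := by
      have hi : Integrable (fun ω => -t * X ω - -t * e) μ :=
        (hXi.const_mul _).sub (integrable_const _)
      rw [integral_add hi (integrable_const _),
        integral_sub (hXi.const_mul _) (integrable_const _), integral_const_mul, ← he]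
      simp
    rwa [integral_const_mul, h2, mul_one] at h1
  have hadd : ∫ ω, Real.exp (t * X ω) ∂μ + ∫ ω, Real.exp (-t * X ω) ∂μ =
      2 * Real.exp (v * t ^ 2 / 2) := by
    rw [← integral_add (hXint t) (hXint (-t)), integral_congr_ae (hsum t),
      integral_add (hYint t) (hYint (-t)), hYmgf, hYmgf, neg_sq]
    ring
  have hpos : 0 ≤ ∫ ω, Real.exp (t * X ω) ∂μ := integral_nonneg fun ω => (Real.exp_pos _).le
  simp only [mgf, hexp]
  rw [integral_const_mul]
  calc _ ≤ (∫ ω, Real.exp (-t * X ω) ∂μ) * ∫ ω, Real.exp (t * X ω) ∂μ := by gcongr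
    _ ≤ Real.exp (v * t ^ 2 / 2) ^ 2 := by
      have h := four_mul_le_sq_add (∫ ω, Real.exp (t * X ω) ∂μ) (∫ ω, Real.exp (-t * X ω) ∂μ)
      rw [hadd] at h
      linarith
    _ = _ := by rw [← Real.exp_nat_mul]; push_cast; ring_nf

theorem evNorm_eq_norm {n : ℕ} (x : Fin n → ℝ) : evNorm x = ‖WithLp.toLp 2 x‖ := by
  simp [evNorm, EuclideanSpace.norm_eq]

open scoped RealInnerProductSpace in
theorem evInner_eq_inner {n : ℕ} (u v : Fin n → ℝ) :
    evInner u v = ⟪(WithLp.toLp 2 v : EuclideanSpace ℝ (Fin n)), WithLp.toLp 2 u⟫ := by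
  simp [evInner, PiLp.inner_apply]

theorem measurable_evInner_left {n : ℕ} (u : Fin n → ℝ) : Measurable fun a => evInner a u := by
  unfold evInner
  fun_prop

instance isProbabilityMeasure_stdGaussianVec (n : ℕ) : IsProbabilityMeasure (stdGaussianVec n) := by
  unfold stdGaussianVec
  infer_instance

instance isProbabilityMeasure_stdGaussianMatrix (m n : ℕ) :
    IsProbabilityMeasure (stdGaussianMatrix m n) := by
  unfold stdGaussianMatrix
  infer_instance

theorem isProbabilityMeasure_etaMeasure {α : ℝ} (h0 : 0 ≤ α) (h1 : α ≤ 1) :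
    IsProbabilityMeasure (etaMeasure α) := by
  refine ⟨?_⟩
  simp only [etaMeasure, Measure.add_apply, Measure.smul_apply, measure_univ]
  rw [ENNReal.smul_def, ENNReal.smul_def, smul_eq_mul, smul_eq_mul, mul_one, mul_one,
    ← ENNReal.coe_add, ← Real.toNNReal_add h0 (by linarith)]
  simp

theorem integral_etaMeasure {α : ℝ} (h0 : 0 ≤ α) (h1 : α ≤ 1) :
    ∫ e, e ∂(etaMeasure α) = 2 * α - 1 := by
  have h2 : ∀ (c : NNReal) (a : ℝ), Integrable (fun e : ℝ => e) (c • Measure.dirac a) :=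
    fun c a => Integrable.smul_measure_nnreal (integrable_dirac (by simp))
  rw [etaMeasure, integral_add_measure (h2 _ _) (h2 _ _), integral_smul_nnreal_measure,
    integral_smul_nnreal_measure, integral_dirac, integral_dirac, NNReal.smul_def, NNReal.smul_def,
    Real.coe_toNNReal _ h0, Real.coe_toNNReal _ (by linarith)]
  simp
  ring

theorem ae_etaMeasure_abs (α : ℝ) : ∀ᵐ e ∂(etaMeasure α), |e| = 1 := by
  have hs : MeasurableSet {e : ℝ | |e| = 1} := measurableSet_eq_fun (by fun_prop) (by fun_prop)
  rw [etaMeasure, ae_add_measure_iff]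
  constructor <;> refine Measure.ae_smul_measure ?_ _ <;> rw [ae_dirac_iff hs] <;> simp

theorem stdGaussianVec_map_toLp (n : ℕ) :
    (stdGaussianVec n).map (WithLp.toLp 2) = stdGaussian (EuclideanSpace ℝ (Fin n)) :=
  map_pi_eq_stdGaussian

theorem stdGaussianVec_map_evInner {n : ℕ} (u : Fin n → ℝ) :
    (stdGaussianVec n).map (fun a => evInner a u) = gaussianReal 0 (evNorm u ^ 2).toNNReal := by
  have h := stdGaussian_map_inner (WithLp.toLp 2 u : EuclideanSpace ℝ (Fin n))
  rw [← stdGaussianVec_map_toLp, Measure.map_map (by fun_prop) (by fun_prop)] at h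
  have h2 : (evNorm u ^ 2).toNNReal = ‖(WithLp.toLp 2 u : EuclideanSpace ℝ (Fin n))‖₊ ^ 2 := by
    rw [evNorm_eq_norm]
    ext
    rw [Real.coe_toNNReal _ (sq_nonneg _)]
    simp
  rw [h2, ← h]
  congr 1

/-- One signed measurement of `u`, where `p.1` is the Gaussian row and `p.2` the sign flip. -/
def signedMeasurement {n : ℕ} (xstar u : Fin n → ℝ) (p : (Fin n → ℝ) × ℝ) : ℝ :=
  p.2 * (sgn (evInner p.1 xstar) * evInner p.1 u)

theorem measurable_signedMeasurement {n : ℕ} (xstar u : Fin n → ℝ) :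
    Measurable (signedMeasurement xstar u) :=
  measurable_snd.mul (((measurable_sgn.comp (measurable_evInner_left xstar)).comp
    measurable_fst).mul ((measurable_evInner_left u).comp measurable_fst))

theorem integral_signedMeasurement {n : ℕ} {xstar : Fin n → ℝ} (hx : evNorm xstar = 1)
    (u : Fin n → ℝ) {α : ℝ} (h0 : 0 ≤ α) (h1 : α ≤ 1) :
    ∫ p, signedMeasurement xstar u p ∂((stdGaussianVec n).prod (etaMeasure α)) =
      (2 * α - 1) * (Real.sqrt (2 / Real.pi) * evInner xstar u) := by
  have := isProbabilityMeasure_etaMeasure h0 h1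
  have h := integral_sgn_inner_mul_inner (x := (WithLp.toLp 2 xstar : EuclideanSpace ℝ (Fin n)))
    (by rw [← evNorm_eq_norm, hx]) (WithLp.toLp 2 u)
  have hmeas : Measurable fun a : EuclideanSpace ℝ (Fin n) =>
      sgn (inner ℝ (WithLp.toLp 2 xstar) a) * inner ℝ (WithLp.toLp 2 u) a :=
    (measurable_sgn.comp (by fun_prop)).mul (by fun_prop)
  rw [← stdGaussianVec_map_toLp, integral_map (by fun_prop) hmeas.aestronglyMeasurable] at h
  simp_rw [← evInner_eq_inner] at h
  have hprod := integral_prod_mul (μ := stdGaussianVec n) (ν := etaMeasure α)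
    (fun a => sgn (evInner a xstar) * evInner a u) (fun e => e)
  have hcomm : evInner u xstar = evInner xstar u := by simp [evInner, mul_comm]
  rw [h, integral_etaMeasure h0 h1, hcomm] at hprod
  rw [mul_comm (2 * α - 1), ← hprod]
  exact integral_congr_ae (Filter.Eventually.of_forall fun p => mul_comm _ _)

theorem hasSubgaussianMGF_signedMeasurement {n : ℕ} {xstar : Fin n → ℝ} (hx : evNorm xstar = 1)
    {u : Fin n → ℝ} {ρ : NNReal} (hu : evNorm u ≤ ρ) {α : ℝ} (h0 : 0 ≤ α) (h1 : α ≤ 1) :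
    HasSubgaussianMGF (fun p => signedMeasurement xstar u p -
      (2 * α - 1) * (Real.sqrt (2 / Real.pi) * evInner xstar u)) (2 * ρ ^ 2)
      ((stdGaussianVec n).prod (etaMeasure α)) := by
  have := isProbabilityMeasure_etaMeasure h0 h1
  have hY : Measurable fun p : (Fin n → ℝ) × ℝ => evInner p.1 u :=
    (measurable_evInner_left u).comp measurable_fst
  have h := hasSubgaussianMGF_sub_integral_of_abs_eq
    (μ := (stdGaussianVec n).prod (etaMeasure α)) (v := (evNorm u ^ 2).toNNReal)
    (measurable_signedMeasurement xstar u) hY.aemeasurable ?_ ?_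
  · rw [integral_signedMeasurement hx u h0 h1] at h
    refine ⟨h.1, fun t => (h.2 t).trans (Real.exp_le_exp.2 ?_)⟩
    have hv : (((2 * (evNorm u ^ 2).toNNReal : NNReal)) : ℝ) ≤ ((2 * ρ ^ 2 : NNReal) : ℝ) := by
      push_cast
      rw [Real.coe_toNNReal _ (sq_nonneg _)]
      have : 0 ≤ evNorm u := Real.sqrt_nonneg _
      gcongr
    gcongr
  · have hae : ∀ᵐ p ∂((stdGaussianVec n).prod (etaMeasure α)), |p.2| = 1 :=
      Measure.quasiMeasurePreserving_snd.ae (ae_etaMeasure_abs α)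
    filter_upwards [hae] with p hp
    rw [signedMeasurement, abs_mul, abs_mul, hp, abs_sgn, one_mul, one_mul]
  · rw [← stdGaussianVec_map_evInner]
    have hfst := Measure.map_fst_prod (μ := stdGaussianVec n) (ν := etaMeasure α)
    rw [measure_univ, one_smul] at hfst
    conv_rhs => rw [← hfst]
    rw [Measure.map_map (measurable_evInner_left u) measurable_fst]
    rfl

/-- The deviation of the linear part of the one-bit loss from its mean, in the direction `u`. -/
def oneBitDeviation {m n : ℕ} (xstar : Fin n → ℝ) (α : ℝ)
    (p : (Fin m → Fin n → ℝ) × (Fin m → ℝ)) (u : Fin n → ℝ) : ℝ :=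
  (Real.sqrt (2 * Real.pi) / m) *
    ∑ i, p.2 i * sgn (evInner (p.1 i) xstar) * evInner (p.1 i) u -
    2 * (2 * α - 1) * evInner xstar u

theorem oneBitDeviation_sub {m n : ℕ} (xstar : Fin n → ℝ) (α : ℝ)
    (p : (Fin m → Fin n → ℝ) × (Fin m → ℝ)) (u v : Fin n → ℝ) :
    oneBitDeviation xstar α p (u - v) = oneBitDeviation xstar α p u - oneBitDeviation xstar α p v := by
  have h : ∀ a : Fin n → ℝ, evInner a (u - v) = evInner a u - evInner a v := fun a => by
    simp [evInner, mul_sub]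
  simp only [oneBitDeviation, h, mul_sub, Finset.sum_sub_distrib]
  ring

theorem sqrt_two_pi_mul_sqrt_two_div_pi :
    Real.sqrt (2 * Real.pi) * Real.sqrt (2 / Real.pi) = 2 := by
  have := Real.pi_pos
  rw [← Real.sqrt_mul (by positivity)]
  have h : 2 * Real.pi * (2 / Real.pi) = 2 ^ 2 := by field_simp
  rw [h, Real.sqrt_sq (by norm_num)]

theorem measure_oneBitDeviation_gt_le {m n : ℕ} (hm : 0 < m) {xstar : Fin n → ℝ}
    (hx : evNorm xstar = 1) {u : Fin n → ℝ} {ρ : ℝ} (hρ : 0 < ρ) (hu : evNorm u ≤ ρ) {α : ℝ}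
    (h0 : 0 ≤ α) (h1 : α ≤ 1) {τ : ℝ} (hτ : 0 ≤ τ) :
    (stdGaussianMatrix m n).prod (etaVec m α) {p | τ < |oneBitDeviation xstar α p u|} ≤
      ENNReal.ofReal (2 * Real.exp (-(m * τ ^ 2 / (8 * Real.pi * ρ ^ 2)))) := by
  have := isProbabilityMeasure_etaMeasure h0 h1
  have hπ := Real.pi_pos
  have hm' : (0 : ℝ) < m := by exact_mod_cast hm
  lift ρ to NNReal using hρ.le
  set ν := (stdGaussianVec n).prod (etaMeasure α)
  set μ := Measure.pi fun _ : Fin m => ν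
  set e := (2 * α - 1) * (Real.sqrt (2 / Real.pi) * evInner xstar u) with he
  let X : (Fin n → ℝ) × ℝ → ℝ := fun p => signedMeasurement xstar u p - e
  have hX : Measurable X := (measurable_signedMeasurement xstar u).sub_const e
  have hsub : HasSubgaussianMGF X (2 * ρ ^ 2) ν :=
    hasSubgaussianMGF_signedMeasurement hx hu h0 h1
  have hcoord : ∀ {Y : (Fin n → ℝ) × ℝ → ℝ} {c : NNReal}, HasSubgaussianMGF Y c ν → ∀ i : Fin m,
      HasSubgaussianMGF (fun ω : Fin m → (Fin n → ℝ) × ℝ => Y (ω i)) c μ := fun {Y c} hY i =>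
    HasSubgaussianMGF.of_map (Y := fun ω : Fin m → (Fin n → ℝ) × ℝ => ω i)
      (measurable_pi_apply i).aemeasurable (by
      rw [(measurePreserving_eval (fun _ : Fin m => ν) i).map_eq]; exact hY)
  have htail : ∀ {Y : (Fin n → ℝ) × ℝ → ℝ}, Measurable Y →
      HasSubgaussianMGF Y (2 * ρ ^ 2) ν →
      μ {ω | m * τ / Real.sqrt (2 * Real.pi) ≤ ∑ i, Y (ω i)} ≤
        ENNReal.ofReal (Real.exp (-(m * τ ^ 2 / (8 * Real.pi * ρ ^ 2)))) := fun {Y} hYm hY => by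
    have h := HasSubgaussianMGF.measure_sum_ge_le_of_iIndepFun
      (iIndepFun_pi (μ := fun _ : Fin m => ν) (X := fun _ => Y) fun _ => hYm.aemeasurable)
      (s := Finset.univ) (fun i _ => hcoord hY i)
      (ε := m * τ / Real.sqrt (2 * Real.pi)) (by positivity)
    rw [← ofReal_measureReal]
    refine ENNReal.ofReal_le_ofReal (h.trans_eq ?_)
    congr 1
    simp only [Finset.sum_const, Finset.card_univ, Fintype.card_fin, nsmul_eq_mul]
    push_cast
    rw [div_pow, Real.sq_sqrt (by positivity)]
    field_simp
    ring
  have hpos := htail hX hsub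
  have hneg := htail hX.neg hsub.neg
  have hmp := measurePreserving_arrowProdEquivProdArrow (Fin n → ℝ) ℝ (Fin m)
    (fun _ => stdGaussianVec n) (fun _ => etaMeasure α)
  rw [stdGaussianMatrix, etaVec, ← hmp.map_eq, MeasurableEquiv.map_apply]
  calc _ ≤ μ ({ω | m * τ / Real.sqrt (2 * Real.pi) ≤ ∑ i, X (ω i)} ∪
        {ω | m * τ / Real.sqrt (2 * Real.pi) ≤ ∑ i, (-X) (ω i)}) := by
        refine measure_mono fun ω hω => ?_
        have hs : (0 : ℝ) < Real.sqrt (2 * Real.pi) := by positivity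
        have hdev : oneBitDeviation xstar α
            (MeasurableEquiv.arrowProdEquivProdArrow (Fin n → ℝ) ℝ (Fin m) ω) u =
            Real.sqrt (2 * Real.pi) / m * ∑ i, X (ω i) := by
          simp only [X, Finset.sum_sub_distrib, Finset.sum_const, Finset.card_univ,
            Fintype.card_fin, nsmul_eq_mul, mul_sub, oneBitDeviation, signedMeasurement]
          congr 1
          · simp only [mul_assoc]; rfl
          · rw [he]
            field_simp
            linear_combination (-((2 * α - 1) * evInner xstar u)) * sqrt_two_pi_mul_sqrt_two_div_pi
        have hω' : τ < |oneBitDeviation xstar α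
            (MeasurableEquiv.arrowProdEquivProdArrow (Fin n → ℝ) ℝ (Fin m) ω) u| := hω
        rw [hdev, abs_mul, abs_of_pos (by positivity), div_mul_eq_mul_div, lt_div_iff₀ hm'] at hω'
        have h3 : m * τ / Real.sqrt (2 * Real.pi) ≤ |∑ i, X (ω i)| := by
          rw [div_le_iff₀ hs]; linarith
        rcases le_abs.1 h3 with h | h
        · exact Or.inl h
        · right
          simpa using h
    _ ≤ _ := (measure_union_le _ _).trans (add_le_add hpos hneg)
    _ = _ := by rw [← ENNReal.ofReal_add (by positivity) (by positivity), two_mul]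

theorem evNorm_nonneg {n : ℕ} (x : Fin n → ℝ) : 0 ≤ evNorm x := Real.sqrt_nonneg _

theorem evNorm_sub_comm {n : ℕ} (x y : Fin n → ℝ) : evNorm (x - y) = evNorm (y - x) := by
  simp only [evNorm_eq_norm, WithLp.toLp_sub, norm_sub_rev]

theorem evNorm_sub_le_add {n : ℕ} (x y z : Fin n → ℝ) :
    evNorm (x - z) ≤ evNorm (x - y) + evNorm (y - z) := by
  simp only [evNorm_eq_norm, WithLp.toLp_sub]
  exact norm_sub_le_norm_sub_add_norm_sub _ _ _

theorem evNorm_le_add_sub {n : ℕ} (x y : Fin n → ℝ) : evNorm x ≤ evNorm y + evNorm (y - x) := by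
  simp only [evNorm_eq_norm, WithLp.toLp_sub]
  exact norm_le_norm_add_norm_sub _ _

theorem abs_evInner_le {n : ℕ} (u v : Fin n → ℝ) : |evInner u v| ≤ evNorm u * evNorm v := by
  rw [evInner_eq_inner, evNorm_eq_norm, evNorm_eq_norm, mul_comm]
  exact abs_real_inner_le_norm _ _

theorem sq_evNorm {n : ℕ} (x : Fin n → ℝ) : evNorm x ^ 2 = ∑ i, x i ^ 2 :=
  Real.sq_sqrt (Finset.sum_nonneg fun _ _ => sq_nonneg _)

theorem sq_evNorm_sub {n : ℕ} (x y : Fin n → ℝ) :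
    evNorm (x - y) ^ 2 = evNorm x ^ 2 - 2 * evInner y x + evNorm y ^ 2 := by
  simp only [sq_evNorm, evInner, Finset.mul_sum, ← Finset.sum_sub_distrib, ← Finset.sum_add_distrib]
  refine Finset.sum_congr rfl fun i _ => ?_
  simp only [Pi.sub_apply]
  ring

theorem evNorm_matrix_apply_le {p q N : ℕ} {w : ℝ} (hp : p ≤ N) (hq : q ≤ N) (hw : 0 ≤ w)
    {W : Fin q → Fin p → ℝ} (hW : ∀ j k, |W j k| ≤ w) (v : Fin p → ℝ) :
    evNorm (fun j => ∑ k, W j k * v k) ≤ N * w * evNorm v := by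
  refine Real.sqrt_le_iff.2 ⟨by have := evNorm_nonneg v; positivity, ?_⟩
  have hrow : ∀ j, (∑ k, W j k * v k) ^ 2 ≤ N * w ^ 2 * evNorm v ^ 2 := fun j => by
    calc _ ≤ (∑ k, W j k ^ 2) * ∑ k, v k ^ 2 := Finset.sum_mul_sq_le_sq_mul_sq _ _ _
      _ ≤ (∑ _k : Fin p, w ^ 2) * evNorm v ^ 2 := by
        rw [sq_evNorm]
        exact mul_le_mul_of_nonneg_right (Finset.sum_le_sum fun k _ =>
          sq_le_sq' (abs_le.1 (hW j k)).1 (abs_le.1 (hW j k)).2)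
          (Finset.sum_nonneg fun _ _ => sq_nonneg _)
      _ ≤ _ := by
        rw [Finset.sum_const, Finset.card_univ, Fintype.card_fin, nsmul_eq_mul]
        gcongr
  calc _ ≤ ∑ _j : Fin q, N * w ^ 2 * evNorm v ^ 2 := Finset.sum_le_sum fun j _ => hrow j
    _ = q * (N * w ^ 2 * evNorm v ^ 2) := by simp
    _ ≤ N * (N * w ^ 2 * evNorm v ^ 2) := by gcongr
    _ = _ := by ring

theorem IsLayer.evNorm_sub_le {L w : ℝ} {N p q : ℕ} {φ : (Fin p → ℝ) → (Fin q → ℝ)}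
    (h : IsLayer L w N φ) (hL : 0 ≤ L) (hw : 0 ≤ w) (v v' : Fin p → ℝ) :
    evNorm (φ v - φ v') ≤ L * N * w * evNorm (v - v') := by
  obtain ⟨hp, hq, W, b, σ, hW, hσ, hφ⟩ := h
  rw [hφ, hφ]
  refine (hσ _ _).trans ?_
  have hdiff : ((fun j => (∑ k, W j k * v k) + b j) - fun j => (∑ k, W j k * v' k) + b j) =
      fun j => ∑ k, W j k * (v - v') k := by
    ext j
    simp [mul_sub]
  rw [hdiff, mul_assoc L, mul_assoc L]
  exact mul_le_mul_of_nonneg_left (evNorm_matrix_apply_le hp hq hw hW _) hL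

theorem IsMLP.evNorm_sub_le {L w : ℝ} {N d s n : ℕ} {G : (Fin s → ℝ) → (Fin n → ℝ)}
    (h : IsMLP L w N d s n G) (hL : 0 ≤ L) (hw : 0 ≤ w) (z z' : Fin s → ℝ) :
    evNorm (G z - G z') ≤ (L * N * w) ^ d * evNorm (z - z') := by
  induction h with
  | single h => simpa using h.evNorm_sub_le hL hw z z'
  | comp hG hφ ih =>
    refine (hφ.evNorm_sub_le hL hw _ _).trans ?_
    rw [pow_succ', mul_assoc (L * N * w)]
    exact mul_le_mul_of_nonneg_left (ih z z') (by positivity)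

theorem IsMLP.one_le_depth {L w : ℝ} {N d s n : ℕ} {G : (Fin s → ℝ) → (Fin n → ℝ)}
    (h : IsMLP L w N d s n G) : 1 ≤ d := by
  cases h <;> omega

theorem IsLayer.lipschitz_nonneg {L w : ℝ} {N p q : ℕ} {φ : (Fin p → ℝ) → (Fin q → ℝ)}
    (h : IsLayer L w N φ) (hq : 0 < q) : 0 ≤ L := by
  obtain ⟨-, -, -, -, σ, -, hσ, -⟩ := h
  have h1 := (evNorm_nonneg _).trans (hσ (fun _ => 1) 0)
  have h2 : 0 < evNorm ((fun _ => 1 : Fin q → ℝ) - 0) := by simpa [evNorm] using hq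
  exact nonneg_of_mul_nonneg_left h1 h2

theorem IsMLP.lipschitz_nonneg {L w : ℝ} {N d s n : ℕ} {G : (Fin s → ℝ) → (Fin n → ℝ)}
    (h : IsMLP L w N d s n G) (hn : 0 < n) : 0 ≤ L := by
  cases h with
  | single h => exact h.lipschitz_nonneg hn
  | comp _ hφ => exact hφ.lipschitz_nonneg hn

theorem exists_finset_cover_evNorm_ball (s : ℕ) {r : ℝ} (hr : 0 < r) (k : ℕ) :
    ∃ P : Finset (Fin s → ℝ), P.card ≤ 5 ^ (s * k) ∧
      ∀ z : Fin s → ℝ, evNorm z ≤ r → ∃ p ∈ P, evNorm (z - p) ≤ r / 2 ^ k := by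
  classical
  obtain ⟨P, hP, hPc⟩ := exists_finset_cover_ball_dyadic (EuclideanSpace ℝ (Fin s)) hr k
  refine ⟨P.image WithLp.ofLp, Finset.card_image_le.trans (by simpa using hP), fun z hz => ?_⟩
  rw [evNorm_eq_norm] at hz
  obtain ⟨p, hp, hzp⟩ := hPc _ hz
  refine ⟨_, Finset.mem_image_of_mem _ hp, ?_⟩
  rwa [evNorm_eq_norm, WithLp.toLp_sub]

/-- Finite sets of increments along which every point of `G '' (ball r) ∩ unit ball` can be
approximated at dyadic rate. -/
theorem exists_chaining_increments {s n : ℕ} {G : (Fin s → ℝ) → (Fin n → ℝ)} {Λ r : ℝ} {k₀ : ℕ}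
    (hΛ : 0 ≤ Λ) (hG : ∀ z z', evNorm (G z - G z') ≤ Λ * evNorm (z - z')) (hr : 0 < r)
    (hk₀ : r * Λ ≤ 2 ^ k₀) :
    ∃ U : ℕ → Finset (Fin n → ℝ), (∀ k, ∀ u ∈ U k, evNorm u ≤ 3 / 2 ^ k) ∧
      (∀ k, (U k).card ≤ 25 ^ (s * (k₀ + k))) ∧
      ∀ z, evNorm z ≤ r → evNorm (G z) ≤ 1 → ∃ x : ℕ → Fin n → ℝ, x 0 ∈ U 0 ∧
        (∀ k, x (k + 1) - x k ∈ U (k + 1)) ∧ ∀ k, evNorm (G z - x k) ≤ 1 / 2 ^ k := by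
  classical
  choose P hP hPc using fun k => exists_finset_cover_evNorm_ball s hr (k₀ + k)
  let U : ℕ → Finset (Fin n → ℝ) := fun k => match k with
    | 0 => ((P 0).image G).filter fun u => evNorm u ≤ 3
    | k + 1 => ((P (k + 1) ×ˢ P k).image fun q => G q.1 - G q.2).filter
        fun u => evNorm u ≤ 3 / 2 ^ (k + 1)
  refine ⟨U, fun k u hu => ?_, fun k => ?_, fun z hz hGz => ?_⟩
  · cases k with
    | zero => simpa using (Finset.mem_filter.1 hu).2
    | succ k => exact (Finset.mem_filter.1 hu).2
  · cases k with
    | zero =>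
      calc (U 0).card ≤ (P 0).card := (Finset.card_filter_le _ _).trans Finset.card_image_le
        _ ≤ 5 ^ (s * (k₀ + 0)) := hP 0
        _ ≤ _ := Nat.pow_le_pow_left (by norm_num) _
    | succ k =>
      calc (U (k + 1)).card ≤ (P (k + 1) ×ˢ P k).card :=
            (Finset.card_filter_le _ _).trans Finset.card_image_le
        _ = (P (k + 1)).card * (P k).card := Finset.card_product _ _
        _ ≤ 5 ^ (s * (k₀ + (k + 1))) * 5 ^ (s * (k₀ + k)) := Nat.mul_le_mul (hP _) (hP _)
        _ ≤ 5 ^ (s * (k₀ + (k + 1))) * 5 ^ (s * (k₀ + (k + 1))) := by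
          gcongr <;> omega
        _ = _ := by rw [← mul_pow]; norm_num
  · choose p hp hzp using fun k => hPc k z hz
    have happ : ∀ k, evNorm (G z - G (p k)) ≤ 1 / 2 ^ k := fun k => by
      calc _ ≤ Λ * evNorm (z - p k) := hG _ _
        _ ≤ Λ * (r / 2 ^ (k₀ + k)) := by gcongr; exact hzp k
        _ = r * Λ / 2 ^ (k₀ + k) := by ring
        _ ≤ 2 ^ k₀ / 2 ^ (k₀ + k) := by gcongr
        _ = _ := by rw [pow_add]; field_simp
    refine ⟨fun k => G (p k), ?_, fun k => ?_, happ⟩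
    · refine Finset.mem_filter.2 ⟨Finset.mem_image_of_mem _ (hp 0), ?_⟩
      have h0 := happ 0
      have h1 := evNorm_le_add_sub (G (p 0)) (G z)
      norm_num at h0
      linarith
    · refine Finset.mem_filter.2 ⟨Finset.mem_image.2 ⟨(p (k + 1), p k),
        Finset.mk_mem_product (hp _) (hp _), rfl⟩, ?_⟩
      have h1 := evNorm_sub_le_add (G (p (k + 1))) (G z) (G (p k))
      have h2 := happ (k + 1)
      rw [evNorm_sub_comm] at h2
      have h3 : (3 : ℝ) / 2 ^ (k + 1) = 1 / 2 ^ (k + 1) + 1 / 2 ^ k := by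
        rw [pow_succ]; field_simp; norm_num
      linarith [happ k]

theorem exists_abs_oneBitDeviation_le {m n : ℕ} (xstar : Fin n → ℝ) (α : ℝ)
    (p : (Fin m → Fin n → ℝ) × (Fin m → ℝ)) :
    ∃ M : ℝ, ∀ u, |oneBitDeviation xstar α p u| ≤ M * evNorm u := by
  refine ⟨(Real.sqrt (2 * Real.pi) / m) *
    (∑ i, |p.2 i * sgn (evInner (p.1 i) xstar)| * evNorm (p.1 i)) +
    |2 * (2 * α - 1)| * evNorm xstar, fun u => ?_⟩
  rw [oneBitDeviation, add_mul]
  refine (abs_sub _ _).trans (add_le_add ?_ ?_)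
  · rw [abs_mul, abs_of_nonneg (by positivity), mul_assoc]
    refine mul_le_mul_of_nonneg_left ?_ (by positivity)
    rw [Finset.sum_mul]
    refine (Finset.abs_sum_le_sum_abs _ _).trans (Finset.sum_le_sum fun i _ => ?_)
    rw [abs_mul, mul_assoc]
    exact mul_le_mul_of_nonneg_left (abs_evInner_le _ _) (abs_nonneg _)
  · rw [abs_mul, mul_assoc]
    exact mul_le_mul_of_nonneg_left (abs_evInner_le _ _) (abs_nonneg _)

theorem abs_oneBitDeviation_le_of_chain {m n : ℕ} {xstar : Fin n → ℝ} {α ε : ℝ} (hε : 0 < ε)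
    {p : (Fin m → Fin n → ℝ) × (Fin m → ℝ)} {y : Fin n → ℝ} {x : ℕ → Fin n → ℝ}
    (hxy : ∀ k, evNorm (y - x k) ≤ 1 / 2 ^ k)
    (h0 : |oneBitDeviation xstar α p (x 0)| ≤ ε / 8)
    (h : ∀ k, |oneBitDeviation xstar α p (x (k + 1) - x k)| ≤ ε / 8 * (3 / 4) ^ (k + 1)) :
    |oneBitDeviation xstar α p y| ≤ ε / 2 := by
  obtain ⟨M, hM⟩ := exists_abs_oneBitDeviation_le xstar α p
  have hx : ∀ k, |oneBitDeviation xstar α p (x k)| ≤ ε / 2 * (1 - (3 / 4) ^ (k + 1)) := fun k => by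
    induction k with
    | zero => linarith
    | succ k ih =>
      have h1 := h k
      rw [oneBitDeviation_sub] at h1
      have h2 := abs_add_le (oneBitDeviation xstar α p (x k))
        (oneBitDeviation xstar α p (x (k + 1)) - oneBitDeviation xstar α p (x k))
      rw [add_sub_cancel] at h2
      have h3 : ((3 : ℝ) / 4) ^ (k + 1 + 1) = 3 / 4 * (3 / 4) ^ (k + 1) := pow_succ' _ _
      rw [h3]
      linarith
  have hlim : Filter.Tendsto (fun k : ℕ => ε / 2 + |M| * (1 / 2 : ℝ) ^ k) Filter.atTop
      (nhds (ε / 2 + |M| * 0)) :=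
    ((tendsto_pow_atTop_nhds_zero_of_lt_one (by norm_num) (by norm_num)).const_mul _).const_add _
  rw [mul_zero, add_zero] at hlim
  refine ge_of_tendsto' hlim fun k => ?_
  have h1 := hM (y - x k)
  rw [oneBitDeviation_sub] at h1
  have h2 := abs_add_le (oneBitDeviation xstar α p (x k))
    (oneBitDeviation xstar α p y - oneBitDeviation xstar α p (x k))
  rw [add_sub_cancel] at h2
  have h3 : M * evNorm (y - x k) ≤ |M| * (1 / 2) ^ k := by
    refine mul_le_mul (le_abs_self M) ?_ (evNorm_nonneg _) (abs_nonneg M)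
    simpa using hxy k
  have h4 : ε / 2 * (1 - (3 / 4) ^ (k + 1)) ≤ ε / 2 :=
    mul_le_of_le_one_right (by linarith) (by linarith [show (0 : ℝ) ≤ (3 / 4) ^ (k + 1) by positivity])
  linarith [hx k]

theorem evNorm_sub_sq_le_of_abs_oneBitDeviation_le {m s n : ℕ} {G : (Fin s → ℝ) → (Fin n → ℝ)}
    {xstar : Fin n → ℝ} (hx : evNorm xstar = 1) {α r ε δ : ℝ} (hα : 1 / 2 < α) (hα1 : α ≤ 1)
    {p : (Fin m → Fin n → ℝ) × (Fin m → ℝ)}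
    (hp : ∀ z, evNorm z ≤ r → evNorm (G z) ≤ 1 → |oneBitDeviation xstar α p (G z)| ≤ ε / 2)
    {zt : Fin s → ℝ} (hzt : evNorm zt ≤ r) (hGzt : evNorm (G zt) ≤ 1)
    (hmin : ocsLoss p.1 (fun i => p.2 i * sgn (evInner (p.1 i) xstar)) (G zt) ≤
      sInf {t : ℝ | ∃ z : Fin s → ℝ, evNorm z ≤ r ∧ evNorm (G z) ≤ 1 ∧
        t = ocsLoss p.1 (fun i => p.2 i * sgn (evInner (p.1 i) xstar)) (G z)} + δ) :
    evNorm (G zt - xstar) ^ 2 ≤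
      sInf {t : ℝ | ∃ z : Fin s → ℝ, evNorm z ≤ r ∧ evNorm (G z) ≤ 1 ∧
        t = evNorm (G z - xstar) ^ 2} +
      (δ + ε) / (2 * α - 1) + 2 * (1 - α) / (2 * α - 1) := by
  have hβ : 0 < 2 * α - 1 := by linarith
  have hloss : ∀ u, ocsLoss p.1 (fun i => p.2 i * sgn (evInner (p.1 i) xstar)) u =
      evNorm u ^ 2 - 2 * (2 * α - 1) * evInner xstar u - oneBitDeviation xstar α p u := fun u => by
    rw [ocsLoss, oneBitDeviation]; ring
  have hbdd : BddBelow {t : ℝ | ∃ z : Fin s → ℝ, evNorm z ≤ r ∧ evNorm (G z) ≤ 1 ∧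
      t = ocsLoss p.1 (fun i => p.2 i * sgn (evInner (p.1 i) xstar)) (G z)} := by
    refine ⟨-2 - ε / 2, ?_⟩
    rintro t ⟨z, hz, hGz, rfl⟩
    rw [hloss]
    have h1 := (abs_le.1 (hp z hz hGz)).2
    have h2 := (abs_le.1 (abs_evInner_le xstar (G z))).2
    rw [hx, one_mul] at h2
    have h3 : evInner xstar (G z) ≤ 1 := h2.trans hGz
    nlinarith [sq_nonneg (evNorm (G z))]
  rw [add_assoc, ← add_div, ← sub_le_iff_le_add]
  refine le_csInf ⟨_, zt, hzt, hGzt, rfl⟩ ?_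
  rintro t ⟨z, hz, hGz, rfl⟩
  have h1 := hmin.trans (add_le_add_left (csInf_le hbdd ⟨z, hz, hGz, rfl⟩) δ)
  rw [hloss, hloss] at h1
  have h2 := (abs_le.1 (hp z hz hGz)).1
  have h3 := (abs_le.1 (hp zt hzt hGzt)).2
  rw [sub_le_iff_le_add, ← sub_le_iff_le_add', le_div_iff₀ hβ, sq_evNorm_sub, sq_evNorm_sub]
  have h4 : evNorm (G z) ^ 2 ≤ 1 := pow_le_one₀ (evNorm_nonneg _) hGz
  have h5 : 2 * (1 - α) * evNorm (G z) ^ 2 ≤ 2 * (1 - α) * 1 :=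
    mul_le_mul_of_nonneg_left h4 (by linarith)
  have h6 : 0 ≤ 2 * (1 - α) * evNorm (G zt) ^ 2 := mul_nonneg (by linarith) (sq_nonneg _)
  linarith

theorem card_mul_tail_le {s k₀ k N : ℕ} {B M : ℝ} (hk₀ : (k₀ : ℝ) + 1 ≤ 5 * B)
    (hN : N ≤ 25 ^ (s * (k₀ + k))) (hM : 600000 * (s * B) ≤ M) {ε : ℝ} {m : ℕ} (hε : 0 < ε)
    (hMm : M = ε ^ 2 * m) :
    N * (2 * Real.exp (-(m * (ε / 8 * (3 / 4) ^ k) ^ 2 / (8 * Real.pi * (3 / 2 ^ k) ^ 2)))) ≤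
      2 * Real.exp (-(1 / 30000 * M)) ^ (k + 1) := by
  have hM0 : 0 ≤ M := by rw [hMm]; positivity
  have hN' : (N : ℝ) ≤ Real.exp (1 / 30000 * M * (k + 1)) := by
    have h25 : (25 : ℝ) ≤ Real.exp 4 := by
      have h1 : Real.exp 4 = Real.exp 1 ^ 4 := by rw [← Real.exp_nat_mul]; norm_num
      rw [h1]
      calc (25 : ℝ) ≤ 2.7 ^ 4 := by norm_num
        _ ≤ _ := by gcongr; linarith [Real.exp_one_gt_d9]
    calc (N : ℝ) ≤ 25 ^ (s * (k₀ + k)) := by exact_mod_cast hN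
      _ ≤ Real.exp 4 ^ (s * (k₀ + k)) := by gcongr
      _ = Real.exp (4 * (s * (k₀ + k))) := by
        rw [← Real.exp_nat_mul]; push_cast; ring_nf
      _ ≤ _ := by
        refine Real.exp_le_exp.2 ?_
        have hk : (0 : ℝ) ≤ k := k.cast_nonneg
        have hk₀' : (0 : ℝ) ≤ k₀ := k₀.cast_nonneg
        have h2 : (k₀ : ℝ) + k ≤ 5 * B * (k + 1) := by nlinarith
        calc 4 * (s * ((k₀ : ℝ) + k)) ≤ 4 * (s * (5 * B * (k + 1))) := by gcongr
          _ = 1 / 30000 * (600000 * (s * B)) * (k + 1) := by ring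
          _ ≤ _ := by gcongr
  have htail : 1 / 15000 * M * (k + 1) ≤
      m * (ε / 8 * (3 / 4) ^ k) ^ 2 / (8 * Real.pi * (3 / 2 ^ k) ^ 2) := by
    have hπ := Real.pi_pos
    have hbern : (k : ℝ) + 1 ≤ (9 / 4) ^ k := by
      have h := one_add_mul_le_pow (show (-2 : ℝ) ≤ 5 / 4 by norm_num) k
      have hk : (0 : ℝ) ≤ k := k.cast_nonneg
      norm_num at h
      linarith
    have heq : m * (ε / 8 * (3 / 4) ^ k) ^ 2 / (8 * Real.pi * (3 / 2 ^ k) ^ 2) =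
        1 / (4608 * Real.pi) * M * (9 / 4) ^ k := by
      have h94 : ((9 : ℝ) / 4) ^ k = ((3 / 4) ^ k) ^ 2 * (2 ^ k) ^ 2 := by
        rw [← pow_mul, ← pow_mul, mul_comm k, pow_mul, pow_mul, ← mul_pow]; norm_num
      rw [h94, hMm]
      field_simp
      ring
    rw [heq]
    gcongr
    nlinarith [Real.pi_lt_d2]
  calc _ ≤ Real.exp (1 / 30000 * M * (k + 1)) * (2 * Real.exp (-(1 / 15000 * M * (k + 1)))) := by
        gcongr
    _ = 2 * (Real.exp (1 / 30000 * M * (k + 1)) * Real.exp (-(1 / 15000 * M * (k + 1)))) := by ring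
    _ = _ := by
      rw [← Real.exp_add, ← Real.exp_nat_mul]
      push_cast
      ring_nf

theorem measure_exists_oneBitDeviation_gt_le {m s n : ℕ} (hm : 0 < m) {xstar : Fin n → ℝ}
    (hx : evNorm xstar = 1) {α ε B : ℝ} (h0 : 0 ≤ α) (h1 : α ≤ 1) (hε : 0 < ε) {k₀ : ℕ}
    (hk₀ : (k₀ : ℝ) + 1 ≤ 5 * B) (hM : 600000 * (s * B) ≤ ε ^ 2 * m)
    (hq : Real.exp (-(1 / 30000 * (ε ^ 2 * m))) ≤ 1 / 2) {U : ℕ → Finset (Fin n → ℝ)}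
    (hU : ∀ k, ∀ u ∈ U k, evNorm u ≤ 3 / 2 ^ k) (hcard : ∀ k, (U k).card ≤ 25 ^ (s * (k₀ + k))) :
    (stdGaussianMatrix m n).prod (etaVec m α)
      {p | ∃ k, ∃ u ∈ U k, ε / 8 * (3 / 4) ^ k < |oneBitDeviation xstar α p u|} ≤
      ENNReal.ofReal (4 * Real.exp (-(1 / 30000 * (ε ^ 2 * m)))) := by
  set q := Real.exp (-(1 / 30000 * (ε ^ 2 * m))) with hqdef
  have hq0 : 0 < q := Real.exp_pos _
  set P := (stdGaussianMatrix m n).prod (etaVec m α)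
  have hlevel : ∀ k, P (⋃ u ∈ U k, {p | ε / 8 * (3 / 4) ^ k < |oneBitDeviation xstar α p u|}) ≤
      ENNReal.ofReal (2 * q ^ (k + 1)) := fun k => by
    refine (measure_biUnion_finset_le _ _).trans ?_
    refine (Finset.sum_le_sum fun u hu => measure_oneBitDeviation_gt_le hm hx
      (by positivity) (hU k u hu) h0 h1 (by positivity)).trans ?_
    rw [Finset.sum_const, nsmul_eq_mul, ← ENNReal.ofReal_natCast, ← ENNReal.ofReal_mul (by positivity)]
    exact ENNReal.ofReal_le_ofReal (card_mul_tail_le hk₀ (hcard k) hM hε rfl)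
  have hsub : {p | ∃ k, ∃ u ∈ U k, ε / 8 * (3 / 4) ^ k < |oneBitDeviation xstar α p u|} ⊆
      ⋃ k, ⋃ u ∈ U k, {p : (Fin m → Fin n → ℝ) × (Fin m → ℝ) |
        ε / 8 * (3 / 4) ^ k < |oneBitDeviation xstar α p u|} := by
    rintro p ⟨k, u, hu, h⟩
    simp only [Set.mem_iUnion]
    exact ⟨k, u, hu, h⟩
  have hsum : HasSum (fun k : ℕ => 2 * q ^ (k + 1)) (2 * q * (1 - q)⁻¹) := by
    have h := (hasSum_geometric_of_lt_one hq0.le (by linarith)).mul_left (2 * q)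
    simpa only [pow_succ', mul_assoc] using h
  calc _ ≤ _ := measure_mono hsub
    _ ≤ ∑' k, ENNReal.ofReal (2 * q ^ (k + 1)) :=
      (measure_iUnion_le _).trans (ENNReal.tsum_le_tsum hlevel)
    _ = ENNReal.ofReal (2 * q * (1 - q)⁻¹) := by
      rw [← ENNReal.ofReal_tsum_of_nonneg (fun k => by positivity) hsum.summable, hsum.tsum_eq]
    _ ≤ _ := by
      refine ENNReal.ofReal_le_ofReal ?_
      rw [← div_eq_mul_inv, div_le_iff₀ (by linarith)]
      nlinarith

theorem exists_dyadic_scale {r ℓ : ℝ} {d : ℕ} (hd : 1 ≤ d) (hr : 0 < r) (hℓ : 2 ≤ ℓ) :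
    ∃ k₀ : ℕ, r * ℓ ^ d ≤ 2 ^ k₀ ∧ (k₀ : ℝ) + 1 ≤ 5 * (r ^ 2 + d * Real.log ℓ) := by
  have hlog2 : 2 / 3 ≤ Real.log 2 := by linarith [Real.log_two_gt_d9]
  have hlogℓ : Real.log 2 ≤ Real.log ℓ := Real.log_le_log (by norm_num) hℓ
  have hd' : (1 : ℝ) ≤ d := by exact_mod_cast hd
  set B := r ^ 2 + d * Real.log ℓ with hB
  have hB0 : 2 / 3 ≤ B := by nlinarith [sq_nonneg r]
  refine ⟨⌈2 * B⌉₊, ?_, by linarith [Nat.ceil_lt_add_one (show 0 ≤ 2 * B by linarith)]⟩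
  have h1 : r ≤ Real.exp (r ^ 2) := by nlinarith [Real.add_one_le_exp (r ^ 2), sq_nonneg (r - 1)]
  have h2 : ℓ ^ d = Real.exp (d * Real.log ℓ) := by
    rw [Real.exp_nat_mul, Real.exp_log (by linarith)]
  have h3 : (2 : ℝ) ^ ⌈2 * B⌉₊ = Real.exp (⌈2 * B⌉₊ * Real.log 2) := by
    rw [Real.exp_nat_mul, Real.exp_log (by norm_num)]
  calc r * ℓ ^ d ≤ Real.exp (r ^ 2) * Real.exp (d * Real.log ℓ) := by rw [h2]; gcongr
    _ = Real.exp B := by rw [← Real.exp_add]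
    _ ≤ _ := by
      rw [h3]
      refine Real.exp_le_exp.2 ?_
      nlinarith [Nat.le_ceil (2 * B)]

/-- Corollary 1 (one-bit CS with random sign flips). -/
theorem one_bit_cs_generative_noisy :
    ∃ C > (0 : ℝ), ∃ c > (0 : ℝ),
      ∀ (s n d N : ℕ) (L wmax : ℝ) (G : (Fin s → ℝ) → (Fin n → ℝ)),
        IsMLP L wmax N d s n G →
        2 ≤ L * (N : ℝ) * wmax →
        ∀ xstar : Fin n → ℝ, evNorm xstar = 1 →
        ∀ (m : ℕ) (α r ε δ : ℝ), 1 / 2 < α → α ≤ 1 → 0 < r → 0 < ε → 0 ≤ δ →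
        C * (ε ^ 2)⁻¹ * (s : ℝ) * (r ^ 2 + (d : ℝ) * Real.log (L * (N : ℝ) * wmax)) ≤ (m : ℝ) →
        ENNReal.ofReal (1 - 4 * Real.exp (-(c * ε ^ 2 * (m : ℝ)))) ≤
          (stdGaussianMatrix m n).prod (etaVec m α)
            {p | ∀ zt : Fin s → ℝ, evNorm zt ≤ r → evNorm (G zt) ≤ 1 →
              ocsLoss p.1 (fun i => p.2 i * sgn (evInner (p.1 i) xstar)) (G zt) ≤
                sInf {t : ℝ | ∃ z : Fin s → ℝ, evNorm z ≤ r ∧ evNorm (G z) ≤ 1 ∧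
                  t = ocsLoss p.1 (fun i => p.2 i * sgn (evInner (p.1 i) xstar)) (G z)} + δ →
              evNorm (G zt - xstar) ^ 2 ≤
                sInf {t : ℝ | ∃ z : Fin s → ℝ, evNorm z ≤ r ∧ evNorm (G z) ≤ 1 ∧
                  t = evNorm (G z - xstar) ^ 2} +
                (δ + ε) / (2 * α - 1) + 2 * (1 - α) / (2 * α - 1)} := by
  refine ⟨600000, by norm_num, 1 / 30000, by norm_num, ?_⟩
  intro s n d N L w G hG hLNw xstar hx m α r ε δ hα hα1 hr hε _ hm
  have hα0 : 0 ≤ α := by linarith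
  have hassoc : 1 / 30000 * ε ^ 2 * (m : ℝ) = 1 / 30000 * (ε ^ 2 * m) := by ring
  rw [hassoc]
  set q := Real.exp (-(1 / 30000 * (ε ^ 2 * m))) with hqdef
  rcases le_or_gt (1 - 4 * q) 0 with hq | hq
  · rw [ENNReal.ofReal_of_nonpos hq]
    exact zero_le
  have hm0 : 0 < m := by
    rcases Nat.eq_zero_or_pos m with rfl | h
    · norm_num [hqdef] at hq
    · exact h
  have hn : 0 < n := by
    rcases Nat.eq_zero_or_pos n with rfl | h
    · simp [evNorm] at hx
    · exact h
  have hL := hG.lipschitz_nonneg hn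
  have hw : 0 ≤ w := by
    by_contra! hw
    nlinarith [mul_nonneg hL (Nat.cast_nonneg (α := ℝ) N)]
  obtain ⟨k₀, hk₀, hk₀B⟩ := exists_dyadic_scale hG.one_le_depth hr hLNw
  have hM : 600000 * (s * (r ^ 2 + d * Real.log (L * N * w))) ≤ ε ^ 2 * m := by
    have h := mul_le_mul_of_nonneg_left hm (sq_nonneg ε)
    refine le_trans (le_of_eq ?_) h
    field_simp
  obtain ⟨U, hU, hcard, hchain⟩ :=
    exists_chaining_increments (by positivity) (hG.evNorm_sub_le hL hw) hr hk₀
  have hbad := measure_exists_oneBitDeviation_gt_le hm0 hx hα0 hα1 hε hk₀B hM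
    (by linarith) hU hcard
  have := isProbabilityMeasure_etaMeasure hα0 hα1
  have : IsProbabilityMeasure (etaVec m α) := by unfold etaVec; infer_instance
  rw [ENNReal.ofReal_sub _ (by positivity), ENNReal.ofReal_one, tsub_le_iff_right]
  rw [← measure_univ (μ := (stdGaussianMatrix m n).prod (etaVec m α))]
  refine (measure_mono ?_).trans ((measure_union_le _ _).trans (add_le_add_right hbad _))
  rintro p -
  by_cases hp : ∃ k, ∃ u ∈ U k, ε / 8 * (3 / 4) ^ k < |oneBitDeviation xstar α p u|
  · exact Or.inr hp
  · push Not at hp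
    refine Or.inl fun zt hzt hGzt hmin =>
      evNorm_sub_sq_le_of_abs_oneBitDeviation_le hx hα hα1 (fun z hz hGz => ?_) hzt hGzt hmin
    obtain ⟨x, hx0, hxs, hxG⟩ := hchain z hz hGz
    exact abs_oneBitDeviation_le_of_chain hε hxG (by simpa using hp 0 _ hx0)
      fun k => hp _ _ (hxs k)
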